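/- In the free group F = FreeGroup (Fin 4) on four generators, the subgroup H₁ = Subgroup.closure {x₁, x₂} is malnormal in F: for every g ∈ F with g ∉ H₁, the intersection H₁ ∩ g⁻¹H₁g is the trivial subgroup. -/

import Mathlib

/-- The conjugate subgroup `g⁻¹ H g = {g⁻¹ h g : h ∈ H}`. -/
def conjSub {G : Type*} [Group G] (g : G) (H : Subgroup G) : Subgroup G :=
  H.map (MulAut.conj g⁻¹).toMonoidHom

namespace FreeGroup

variable {α : Type*} {S : Set α}

theorem mk_singleton_mem_closure {a : α × Bool} (ha : a.1 ∈ S) :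
    mk [a] ∈ Subgroup.closure (of '' S) := by
  have h : of a.1 ∈ Subgroup.closure (of '' S) := Subgroup.subset_closure ⟨_, ha, rfl⟩
  rcases a with ⟨a, _ | _⟩
  · simpa [of, inv_mk, FreeGroup.invRev] using inv_mem h
  · exact h

variable [DecidableEq α]

theorem fst_mem_of_mem_toWord {x : FreeGroup α} (hx : x ∈ Subgroup.closure (of '' S)) :
    ∀ p ∈ x.toWord, p.1 ∈ S := by
  induction hx using Subgroup.closure_induction with
  | mem x hx =>
    obtain ⟨s, hs, rfl⟩ := hx
    simpa using hs
  | one => simp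
  | mul x y _ _ hx hy =>
    intro p hp
    rw [toWord_mul] at hp
    rcases List.mem_append.1 (reduce.red.sublist.subset hp) with h | h
    exacts [hx p h, hy p h]
  | inv x _ hx =>
    rintro ⟨a, b⟩ hp
    rw [toWord_inv] at hp
    have h : (a, !b) ∈ x.toWord := by simpa [invRev] using hp
    exact hx (a, !b) h

theorem IsReduced.invRev {L : List (α × Bool)} (h : IsReduced L) :
    IsReduced (FreeGroup.invRev L) := by
  rw [isReduced_iff_reduce_eq, reduce_invRev, h.reduce_eq]

theorem isReduced_toWord_append {x : FreeGroup α} (hx : x ∈ Subgroup.closure (of '' S))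
    {a : α × Bool} {L : List (α × Bool)} (ha : a.1 ∉ S) (hL : IsReduced (a :: L)) :
    IsReduced (x.toWord ++ a :: L) := by
  refine List.isChain_append.2 ⟨isReduced_toWord, hL, ?_⟩
  intro p hp q hq hpq
  obtain rfl : a = q := by simpa using hq
  exact absurd (hpq ▸ fst_mem_of_mem_toWord hx p (List.mem_of_mem_getLast? hp)) ha

/-- The subgroup generated by part of a basis of a free group is malnormal. -/
theorem eq_one_of_conj_mem_closure {g h : FreeGroup α}
    (hg : g ∉ Subgroup.closure (of '' S)) (hh : h ∈ Subgroup.closure (of '' S))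
    (hc : g⁻¹ * h * g ∈ Subgroup.closure (of '' S)) : h = 1 := by
  obtain ⟨L, hL, rfl⟩ : ∃ L, IsReduced L ∧ mk L = g := ⟨_, isReduced_toWord, mk_toWord⟩
  induction L generalizing h with
  | nil => exact absurd (one_mem _) hg
  | cons a L ih =>
    by_cases ha : a.1 ∈ S
    · have hs := mk_singleton_mem_closure ha
      have hmk : mk (a :: L) = mk [a] * mk L := by simp
      rw [hmk] at hg hc
      have key : (mk [a])⁻¹ * h * mk [a] = 1 := by
        refine ih (mul_mem (mul_mem (inv_mem hs) hh) hs)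
          (hL.infix (List.suffix_cons a L).isInfix) (fun hL' => hg (mul_mem hs hL')) ?_
        convert hc using 1
        group
      rw [mul_assoc, inv_mul_eq_one] at key
      exact mul_eq_right.1 key.symm
    · by_contra h1
      have hleft : IsReduced (FreeGroup.invRev (a :: L) ++ h.toWord) := by
        have := (isReduced_toWord_append (inv_mem hh) ha hL).invRev
        rwa [invRev_append, toWord_inv, invRev_invRev] at this
      have hred := hleft.append_overlap (isReduced_toWord_append hh ha hL)
        (mt toWord_eq_nil_iff.1 h1)
      have hw : ((mk (a :: L))⁻¹ * h * mk (a :: L)).toWord =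
          FreeGroup.invRev (a :: L) ++ h.toWord ++ a :: L := by
        rw [← hred.reduce_eq, ← toWord_mk, ← mul_mk, ← mul_mk, mk_toWord, inv_mk]
      refine ha (fst_mem_of_mem_toWord hc a ?_)
      rw [hw]
      simp

end FreeGroup

theorem stmt8 :
    ∀ g : FreeGroup (Fin 4),
      g ∉ Subgroup.closure {FreeGroup.of (0 : Fin 4), FreeGroup.of 1} →
      Subgroup.closure {FreeGroup.of (0 : Fin 4), FreeGroup.of 1} ⊓
        conjSub g (Subgroup.closure {FreeGroup.of (0 : Fin 4), FreeGroup.of 1}) = ⊥ := by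
  intro g hg
  rw [← Set.image_pair] at hg ⊢
  rw [eq_bot_iff]
  rintro _ ⟨hc, h, hh, rfl⟩
  have h1 : h = 1 := FreeGroup.eq_one_of_conj_mem_closure hg hh (by simpa using hc)
  simp [h1]
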